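/- For k ∈ {27, 35}, the packing number A(6k+5,4,4) equals the Johnson bound J(6k+5,4,4); that is, A(167,4,4) = J(167,4,4) and A(215,4,4) = J(215,4,4). -/

import Mathlib

/-- A 3-(n,4,1) packing design (packing quadruple system PQS(n)) on the point
set `Fin n`: a collection of 4-element blocks such that every 3-element subset
of points is contained in at most one block. -/
def IsPQS (n : ℕ) (B : Finset (Finset (Fin n))) : Prop :=
  (∀ b ∈ B, b.card = 4) ∧
  ∀ t : Finset (Fin n), t.card = 3 → (B.filter (fun b => t ⊆ b)).card ≤ 1

/-- The packing number A(n,4,4): the maximum number of blocks in a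
3-(n,4,1) packing design. -/
noncomputable def packingNumber (n : ℕ) : ℕ :=
  sSup {N | ∃ B : Finset (Finset (Fin n)), IsPQS n B ∧ B.card = N}

/-- The Johnson bound J(n,4,4). -/
def johnsonBound (n : ℕ) : ℕ :=
  if n % 6 = 0 then n * ((n - 1) * ((n - 2) / 2) / 3) / 4 - 1
  else n * ((n - 1) * ((n - 2) / 2) / 3) / 4

open Finset

section Packing

variable {α β ι : Type*} [DecidableEq α] [DecidableEq β]

/-- A family of 4-element sets, any two of which share at most two points. -/
def IsQuadPacking (B : Finset (Finset α)) : Prop :=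
  (∀ b ∈ B, #b = 4) ∧ ∀ b ∈ B, ∀ b' ∈ B, 3 ≤ #(b ∩ b') → b = b'

theorem IsQuadPacking.image {B : Finset (Finset α)} (h : IsQuadPacking B) {s : Set α}
    (hs : ∀ b ∈ B, ↑b ⊆ s) {f : α → β} (hf : Set.InjOn f s) :
    IsQuadPacking (B.image (Finset.image f)) ∧ #(B.image (Finset.image f)) = #B := by
  have key : ∀ b ∈ B, ∀ b' ∈ B, 3 ≤ #(b.image f ∩ b'.image f) → b = b' := by
    intro b hb b' hb' h3
    have hinj : Set.InjOn f (↑b ∪ ↑b') := hf.mono (Set.union_subset (hs b hb) (hs b' hb'))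
    rw [← image_inter_of_injOn _ _ hinj] at h3
    exact h.2 b hb b' hb' (h3.trans card_image_le)
  have hcard : ∀ b ∈ B, #(b.image f) = 4 := fun b hb => by
    rw [card_image_of_injOn (hf.mono (hs b hb)), h.1 b hb]
  refine ⟨⟨?_, ?_⟩, card_image_of_injOn ?_⟩
  · simpa using hcard
  · simp only [mem_image]
    rintro _ ⟨b, hb, rfl⟩ _ ⟨b', hb', rfl⟩ h3
    rw [key b hb b' hb' h3]
  · intro b hb b' hb' (e : b.image f = b'.image f)
    refine key b hb b' hb' ?_
    rw [← e, inter_self, hcard b hb]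
    norm_num

theorem IsQuadPacking.union {A B : Finset (Finset α)} (hA : IsQuadPacking A)
    (hB : IsQuadPacking B) (h : ∀ a ∈ A, ∀ b ∈ B, #(a ∩ b) ≤ 2) :
    IsQuadPacking (A ∪ B) ∧ #(A ∪ B) = #A + #B := by
  refine ⟨⟨fun b hb => (mem_union.1 hb).elim (hA.1 b) (hB.1 b), ?_⟩, card_union_of_disjoint ?_⟩
  · intro b hb b' hb' h3
    rcases mem_union.1 hb with hb | hb <;> rcases mem_union.1 hb' with hb' | hb'
    · exact hA.2 b hb b' hb' h3
    · have := h b hb b' hb'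
      omega
    · have := h b' hb' b hb
      rw [inter_comm] at this
      omega
    · exact hB.2 b hb b' hb' h3
  · refine disjoint_left.2 fun b hb hb' => ?_
    have := h b hb b hb'
    rw [inter_self, hA.1 b hb] at this
    omega

theorem IsQuadPacking.biUnion [DecidableEq ι] {I : Finset ι} {F : ι → Finset (Finset α)}
    (hF : ∀ i ∈ I, IsQuadPacking (F i))
    (h : ∀ i ∈ I, ∀ j ∈ I, i ≠ j → ∀ b ∈ F i, ∀ b' ∈ F j, #(b ∩ b') ≤ 2) :
    IsQuadPacking (I.biUnion F) ∧ #(I.biUnion F) = ∑ i ∈ I, #(F i) := by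
  induction I using Finset.induction_on with
  | empty => simp [IsQuadPacking]
  | insert i I hi ih =>
    obtain ⟨h1, h2⟩ := ih (fun j hj => hF j (mem_insert_of_mem hj))
      fun j hj k hk => h j (mem_insert_of_mem hj) k (mem_insert_of_mem hk)
    rw [biUnion_insert, sum_insert hi, ← h2]
    refine (hF i (mem_insert_self i I)).union h1 fun b hb b' hb' => ?_
    obtain ⟨j, hj, hb'⟩ := mem_biUnion.1 hb'
    exact h i (mem_insert_self i I) j (mem_insert_of_mem hj) (ne_of_mem_of_not_mem hj hi).symm
      b hb b' hb'

end Packing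

section JohnsonBound

variable {n : ℕ} {B : Finset (Finset (Fin n))}

theorem IsPQS.eq_of_three_le (h : IsPQS n B) {b b' : Finset (Fin n)} (hb : b ∈ B) (hb' : b' ∈ B)
    (h3 : 3 ≤ #(b ∩ b')) : b = b' := by
  obtain ⟨t, ht, ht3⟩ := exists_subset_card_eq h3
  exact card_le_one.1 (h.2 t ht3) b (mem_filter.2 ⟨hb, ht.trans inter_subset_left⟩) b'
    (mem_filter.2 ⟨hb', ht.trans inter_subset_right⟩)

theorem IsPQS.card_pair_le (h : IsPQS n B) {x y : Fin n} (hxy : x ≠ y) :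
    #{b ∈ B | x ∈ b ∧ y ∈ b} ≤ (n - 2) / 2 := by
  have hpair : #({x, y} : Finset (Fin n)) = 2 := card_pair hxy
  have hsub : ∀ b ∈ ({b ∈ B | x ∈ b ∧ y ∈ b} : Finset _), {x, y} ⊆ b := fun b hb => by
    simpa [insert_subset_iff] using (mem_filter.1 hb).2
  have hdisj : Set.PairwiseDisjoint (↑({b ∈ B | x ∈ b ∧ y ∈ b} : Finset _))
      fun b : Finset (Fin n) => b \ {x, y} := by
    intro b hb b' hb' hne
    refine disjoint_left.2 fun z hz hz' => hne ?_
    rw [mem_sdiff] at hz hz'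
    refine h.eq_of_three_le (mem_filter.1 hb).1 (mem_filter.1 hb').1 ?_
    calc 3 = #(insert z {x, y}) := by rw [card_insert_of_notMem hz.2, hpair]
      _ ≤ #(b ∩ b') := card_le_card <| insert_subset (mem_inter.2 ⟨hz.1, hz'.1⟩)
        (subset_inter (hsub b hb) (hsub b' hb'))
  have hcard := card_biUnion hdisj
  rw [sum_congr rfl (g := fun _ => 2) fun b hb => by
    rw [card_sdiff_of_subset (hsub b hb), hpair, h.1 b (mem_filter.1 hb).1], sum_const,
    smul_eq_mul] at hcard
  have hle : #(({b ∈ B | x ∈ b ∧ y ∈ b} : Finset _).biUnion fun b => b \ {x, y}) ≤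
      #(univ \ {x, y} : Finset (Fin n)) :=
    card_le_card <| biUnion_subset.2 fun b _ => sdiff_subset_sdiff (subset_univ b) subset_rfl
  rw [card_sdiff_of_subset (subset_univ _), card_univ, Fintype.card_fin, hpair] at hle
  omega

theorem IsPQS.card_point_le (h : IsPQS n B) (x : Fin n) :
    #{b ∈ B | x ∈ b} ≤ (n - 1) * ((n - 2) / 2) / 3 := by
  rw [Nat.le_div_iff_mul_le (by norm_num)]
  calc #{b ∈ B | x ∈ b} * 3
      = ∑ b ∈ B with x ∈ b, #{y ∈ univ.erase x | y ∈ b} := by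
        rw [sum_congr rfl (g := fun _ => 3), sum_const, smul_eq_mul]
        intro b hb
        obtain ⟨hb, hx⟩ := mem_filter.1 hb
        rw [filter_mem_eq_inter, erase_inter, univ_inter, card_erase_of_mem hx, h.1 b hb]
    _ = ∑ y ∈ univ.erase x, #{b ∈ ({b ∈ B | x ∈ b} : Finset _) | y ∈ b} :=
        (sum_card_bipartiteAbove_eq_sum_card_bipartiteBelow fun b y => y ∈ b)
    _ ≤ ∑ _y ∈ univ.erase x, (n - 2) / 2 := sum_le_sum fun y hy => by
        rw [filter_filter]
        exact h.card_pair_le (ne_of_mem_erase hy).symm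
    _ = (n - 1) * ((n - 2) / 2) := by
        rw [sum_const, smul_eq_mul, card_erase_of_mem (mem_univ x), card_univ, Fintype.card_fin]

theorem IsPQS.card_le (h : IsPQS n B) : #B ≤ n * ((n - 1) * ((n - 2) / 2) / 3) / 4 := by
  rw [Nat.le_div_iff_mul_le (by norm_num)]
  calc #B * 4 = ∑ b ∈ B, #{x ∈ univ | x ∈ b} := by
        rw [sum_congr rfl (g := fun _ => 4), sum_const, smul_eq_mul]
        intro b hb
        rw [filter_mem_eq_inter, univ_inter, h.1 b hb]
    _ = ∑ x : Fin n, #{b ∈ B | x ∈ b} :=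
        (sum_card_bipartiteAbove_eq_sum_card_bipartiteBelow fun b x => x ∈ b)
    _ ≤ ∑ _x : Fin n, (n - 1) * ((n - 2) / 2) / 3 := sum_le_sum fun x _ => h.card_point_le x
    _ = n * ((n - 1) * ((n - 2) / 2) / 3) := by simp

theorem packingNumber_eq_of_card (h : IsPQS n B)
    (hB : #B = n * ((n - 1) * ((n - 2) / 2) / 3) / 4) :
    packingNumber n = n * ((n - 1) * ((n - 2) / 2) / 3) / 4 := by
  have hle : ∀ N ∈ {N | ∃ B : Finset (Finset (Fin n)), IsPQS n B ∧ #B = N},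
      N ≤ n * ((n - 1) * ((n - 2) / 2) / 3) / 4 := by
    rintro _ ⟨B, hB, rfl⟩
    exact hB.card_le
  exact le_antisymm (csSup_le ⟨_, B, h, rfl⟩ hle) (le_csSup ⟨_, hle⟩ ⟨B, h, hB⟩)

theorem IsQuadPacking.exists_isPQS {B : Finset (Finset ℕ)} (hB : IsQuadPacking B)
    (hn : ∀ b ∈ B, ∀ x ∈ b, x < n) : ∃ B' : Finset (Finset (Fin n)), IsPQS n B' ∧ #B' = #B := by
  rcases Nat.eq_zero_or_pos n with rfl | hpos
  · have : B = ∅ := eq_empty_of_forall_notMem fun b hb => by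
      obtain ⟨x, hx⟩ := card_pos.1 (by rw [hB.1 b hb]; norm_num : 0 < #b)
      exact absurd (hn b hb x hx) (Nat.not_lt_zero x)
    exact ⟨∅, ⟨by simp, by simp⟩, by simp [this]⟩
  have hf : Set.InjOn (fun x => (⟨x % n, Nat.mod_lt x hpos⟩ : Fin n)) {x | x < n} := by
    intro x hx y hy hxy
    simpa [Nat.mod_eq_of_lt hx, Nat.mod_eq_of_lt hy] using hxy
  obtain ⟨h1, h2⟩ := hB.image (fun b hb x hx => hn b hb x hx) hf
  refine ⟨_, ⟨h1.1, fun t ht => card_le_one.2 fun b hb b' hb' => ?_⟩, h2⟩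
  obtain ⟨hb, htb⟩ := mem_filter.1 hb
  obtain ⟨hb', htb'⟩ := mem_filter.1 hb'
  exact h1.2 b hb b' hb' (ht ▸ card_le_card (subset_inter htb htb'))

end JohnsonBound

section Quadruples

/-- A quadruple of points. -/
abbrev Quad := ℕ × ℕ × ℕ × ℕ

/-- The set of points of a quadruple. -/
def Quad.points : Quad → Finset ℕ
  | (a, b, c, d) => {a, b, c, d}

/-- The set of blocks described by a list of quadruples. -/
def quadBlocks (l : List Quad) : Finset (Finset ℕ) := (l.map Quad.points).toFinset

/-! Below, arithmetic is written with the functions on `ℕ` that the kernel evaluates directly. -/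

/-- The colexicographic rank of a triple `a < b < c`. -/
def tripleRank (a b c : ℕ) : ℕ :=
  Nat.add (Nat.div (Nat.mul c (Nat.mul (Nat.sub c 1) (Nat.sub c 2))) 6)
    (Nat.add (Nat.div (Nat.mul b (Nat.sub b 1)) 2) a)

/-- The bitmap of the ranks of the four triples of a quadruple. -/
def tripleMask : Quad → ℕ
  | (a, b, c, d) =>
    Nat.lor (Nat.lor (Nat.shiftLeft 1 (tripleRank a b c)) (Nat.shiftLeft 1 (tripleRank a b d)))
      (Nat.lor (Nat.shiftLeft 1 (tripleRank a c d)) (Nat.shiftLeft 1 (tripleRank b c d)))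

/-- Whether a quadruple is strictly increasing with entries below `n`. -/
def isIncreasing (n : ℕ) : Quad → Bool
  | (a, b, c, d) => Nat.blt a b && Nat.blt b c && Nat.blt c d && Nat.blt d n

/-- Whether the quadruples of a list are increasing with entries below `n` and cover no triple
twice, nor any triple marked in the given bitmap. -/
def isPacking (n : ℕ) : List Quad → ℕ → Bool
  | [], _ => true
  | q :: l, marked =>
    isIncreasing n q && Nat.beq (Nat.land marked (tripleMask q)) 0 &&
      isPacking n l (Nat.lor marked (tripleMask q))

theorem isIncreasing_iff {n a b c d : ℕ} :
    isIncreasing n (a, b, c, d) = true ↔ a < b ∧ b < c ∧ c < d ∧ d < n := by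
  simp [isIncreasing, Nat.blt_eq, and_assoc]

theorem testBit_tripleMask {a b c d k : ℕ} : (tripleMask (a, b, c, d)).testBit k = true ↔
    k = tripleRank a b c ∨ k = tripleRank a b d ∨ k = tripleRank a c d ∨ k = tripleRank b c d := by
  change ((1 <<< tripleRank a b c ||| 1 <<< tripleRank a b d) |||
    (1 <<< tripleRank a c d ||| 1 <<< tripleRank b c d)).testBit k = true ↔ _
  simp only [Nat.testBit_or, Nat.one_shiftLeft, Nat.testBit_two_pow, Bool.or_eq_true,
    decide_eq_true_eq, or_assoc, eq_comm (a := k)]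

theorem card_points {n : ℕ} {q : Quad} (h : isIncreasing n q = true) : #q.points = 4 := by
  obtain ⟨a, b, c, d⟩ := q
  rw [isIncreasing_iff] at h
  have h1 : a ∉ ({b, c, d} : Finset ℕ) := by simp; omega
  have h2 : b ∉ ({c, d} : Finset ℕ) := by simp; omega
  rw [Quad.points, card_insert_of_notMem h1, card_insert_of_notMem h2, card_pair (by omega)]

/-- A triple of points of an increasing quadruple is marked in its bitmap. -/
theorem exists_triple_of_subset_points {n : ℕ} {q : Quad} (h : isIncreasing n q = true)
    {t : Finset ℕ} (ht : t ⊆ q.points) (h3 : #t = 3) :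
    ∃ a b c, a < b ∧ b < c ∧ t = {a, b, c} ∧ (tripleMask q).testBit (tripleRank a b c) = true := by
  have h4 := card_points h
  obtain ⟨a, b, c, d⟩ := q
  obtain ⟨x, hx⟩ : ∃ x, Quad.points (a, b, c, d) \ t = {x} :=
    card_eq_one.1 (by rw [card_sdiff_of_subset ht, h4, h3])
  rw [isIncreasing_iff] at h
  have hmem : ∀ y, y ∈ t ↔ (y = a ∨ y = b ∨ y = c ∨ y = d) ∧ y ≠ x := fun y => by
    have h1 := Finset.ext_iff.1 hx y
    have h2 := @ht y
    simp only [Quad.points, mem_sdiff, mem_insert, mem_singleton] at h1 h2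
    tauto
  have hx' : x = a ∨ x = b ∨ x = c ∨ x = d := by
    have := Finset.ext_iff.1 hx x
    simp only [Quad.points, mem_sdiff, mem_insert, mem_singleton] at this
    tauto
  simp only [testBit_tripleMask]
  rcases hx' with rfl | rfl | rfl | rfl
  · refine ⟨b, c, d, by omega, by omega, ?_, by simp⟩
    ext y; simp only [hmem, mem_insert, mem_singleton]; omega
  · refine ⟨a, c, d, by omega, by omega, ?_, by simp⟩
    ext y; simp only [hmem, mem_insert, mem_singleton]; omega
  · refine ⟨a, b, d, by omega, by omega, ?_, by simp⟩
    ext y; simp only [hmem, mem_insert, mem_singleton]; omega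
  · refine ⟨a, b, c, by omega, by omega, ?_, by simp⟩
    ext y; simp only [hmem, mem_insert, mem_singleton]; omega

theorem card_inter_le_of_land_eq_zero {n n' : ℕ} {q r : Quad} (hq : isIncreasing n q = true)
    (hr : isIncreasing n' r = true) (h : tripleMask q &&& tripleMask r = 0) :
    #(q.points ∩ r.points) ≤ 2 := by
  by_contra! h3
  obtain ⟨t, ht, ht3⟩ := exists_subset_card_eq (Nat.succ_le_of_lt h3)
  obtain ⟨a, b, c, hab, hbc, rfl, h1⟩ :=
    exists_triple_of_subset_points hq (ht.trans inter_subset_left) ht3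
  obtain ⟨a', b', c', hab', hbc', heq, h2⟩ :=
    exists_triple_of_subset_points hr (ht.trans inter_subset_right) ht3
  have hmem := fun y => Finset.ext_iff.1 heq y
  simp only [mem_insert, mem_singleton] at hmem
  have ha := hmem a
  have hb := hmem b
  have hc := hmem c
  have ha' := hmem a'
  have hb' := hmem b'
  have hc' := hmem c'
  obtain rfl : a = a' := by omega
  obtain rfl : c = c' := by omega
  obtain rfl : b = b' := by omega
  have := congrArg (Nat.testBit · (tripleRank a b c)) h
  simp [Nat.testBit_and, h1, h2] at this

theorem isPacking_spec {n : ℕ} {l : List Quad} {marked : ℕ} (h : isPacking n l marked = true) :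
    (∀ q ∈ l, isIncreasing n q = true ∧ marked &&& tripleMask q = 0) ∧
      l.Pairwise fun q r => tripleMask q &&& tripleMask r = 0 := by
  induction l generalizing marked with
  | nil => simp
  | cons q l ih =>
    simp only [isPacking, Bool.and_eq_true, Nat.beq_eq] at h
    obtain ⟨⟨h1, h2⟩, h3⟩ := h
    obtain ⟨h4, h5⟩ := ih h3
    have key : ∀ r ∈ l, marked &&& tripleMask r = 0 ∧ tripleMask q &&& tripleMask r = 0 := by
      intro r hr
      have : (marked ||| tripleMask q) &&& tripleMask r = 0 := (h4 r hr).2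
      rwa [Nat.and_or_distrib_right, Nat.or_eq_zero_iff] at this
    refine ⟨fun r hr => ?_, List.pairwise_cons.2 ⟨fun r hr => (key r hr).2, h5⟩⟩
    rcases List.mem_cons.1 hr with rfl | hr
    · exact ⟨h1, h2⟩
    · exact ⟨(h4 r hr).1, (key r hr).1⟩

variable {n : ℕ} {l : List Quad}

theorem isIncreasing_of_isPacking (h : isPacking n l 0 = true) {q : Quad} (hq : q ∈ l) :
    isIncreasing n q = true :=
  ((isPacking_spec h).1 q hq).1

theorem pairwise_of_isPacking (h : isPacking n l 0 = true) :
    l.Pairwise fun q r => #(q.points ∩ r.points) ≤ 2 :=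
  (isPacking_spec h).2.imp_of_mem fun hq hr =>
    card_inter_le_of_land_eq_zero (isIncreasing_of_isPacking h hq) (isIncreasing_of_isPacking h hr)

theorem card_inter_points_le (h : isPacking n l 0 = true) {q r : Quad} (hq : q ∈ l) (hr : r ∈ l)
    (hne : q ≠ r) : #(q.points ∩ r.points) ≤ 2 :=
  haveI : Std.Symm fun q r : Quad => #(q.points ∩ r.points) ≤ 2 :=
    ⟨fun _ _ h => by rwa [inter_comm]⟩
  (pairwise_of_isPacking h).forall hq hr hne

theorem nodup_map_points (h : isPacking n l 0 = true) : (l.map Quad.points).Nodup := by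
  refine List.pairwise_map.2 ((pairwise_of_isPacking h).imp_of_mem fun {q r} hq _ hqr heq => ?_)
  rw [← heq, inter_self, card_points (isIncreasing_of_isPacking h hq)] at hqr
  omega

theorem card_quadBlocks (h : isPacking n l 0 = true) : #(quadBlocks l) = l.length := by
  rw [quadBlocks, List.toFinset_card_of_nodup (nodup_map_points h), List.length_map]

theorem isQuadPacking_quadBlocks (h : isPacking n l 0 = true) : IsQuadPacking (quadBlocks l) := by
  simp only [IsQuadPacking, quadBlocks, List.mem_toFinset, List.mem_map]
  constructor
  · rintro _ ⟨q, hq, rfl⟩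
    exact card_points (isIncreasing_of_isPacking h hq)
  · rintro _ ⟨q, hq, rfl⟩ _ ⟨r, hr, rfl⟩ h3
    by_contra hne
    have := card_inter_points_le h hq hr fun e => hne (e ▸ rfl)
    omega

theorem lt_of_mem_quadBlocks (h : isPacking n l 0 = true) {b : Finset ℕ} (hb : b ∈ quadBlocks l)
    {x : ℕ} (hx : x ∈ b) : x < n := by
  simp only [quadBlocks, List.mem_toFinset, List.mem_map] at hb
  obtain ⟨⟨a, b, c, d⟩, hq, rfl⟩ := hb
  have := isIncreasing_iff.1 (isIncreasing_of_isPacking h hq)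
  simp only [Quad.points, mem_insert, mem_singleton] at hx
  omega

end Quadruples

section Inflation

/-- Replace point `i` by the four points `4 * f i, …, 4 * f i + 3`. -/
def spread (f : ℕ → ℕ) (x : ℕ) : ℕ := 4 * f (x / 4) + x % 4

theorem spread_injOn {f : ℕ → ℕ} {k : ℕ} (hf : Set.InjOn f (Set.Iio k)) :
    Set.InjOn (spread f) (Set.Iio (4 * k)) := by
  intro x hx y hy hxy
  simp only [Set.mem_Iio, spread] at hx hy hxy
  have := hf (show x / 4 ∈ Set.Iio k by simp only [Set.mem_Iio]; omega)
    (show y / 4 ∈ Set.Iio k by simp only [Set.mem_Iio]; omega) (by omega)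
  omega

theorem card_inter_le_of_injOn {B B' : Finset ℕ} {f : ℕ → ℕ} (h : Set.InjOn f B) :
    #(B ∩ B') ≤ #(B.image f ∩ B'.image f) := by
  refine card_le_card_of_injOn f (fun x hx => ?_) (h.mono (by simp))
  rw [mem_coe, mem_inter] at hx ⊢
  exact ⟨mem_image_of_mem f hx.1, mem_image_of_mem f hx.2⟩

/-- Transversal quadruples on four groups of size 4, covering every transversal triple when
`w = 4`. Only the first `w` points of the last group are used. -/
def crossQuads (w : ℕ) : List Quad :=
  (List.range w).flatMap fun s => (List.range 4).flatMap fun r => (List.range 4).map fun q =>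
    ((12 - (q + r + s)) % 4, 4 + q, 8 + r, 12 + s)

/-- Quadruples on two groups of size 4 that cover every triple meeting both groups. -/
def pairQuads : List Quad :=
  [(0, 1, 4, 5), (0, 1, 6, 7), (2, 3, 4, 5), (2, 3, 6, 7), (0, 2, 4, 6), (0, 2, 5, 7),
    (1, 3, 4, 6), (1, 3, 5, 7), (0, 3, 4, 7), (0, 3, 5, 6), (1, 2, 4, 7), (1, 2, 5, 6)]

theorem isPacking_crossQuads {w : ℕ} (hw : w ≤ 4) : isPacking 16 (crossQuads w) 0 = true := by
  interval_cases w <;> decide +kernel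

theorem isPacking_pairQuads : isPacking 8 pairQuads 0 = true := by decide +kernel

/-- The entries of a quadruple. -/
def Quad.entry : Quad → ℕ → ℕ
  | (a, _, _, _), 0 => a
  | (_, b, _, _), 1 => b
  | (_, _, c, _), 2 => c
  | (_, _, _, d), _ => d

/-- The blocks over the points of `q`, with `w` points over the last one. -/
def inflateQuad (w : ℕ) (q : Quad) : Finset (Finset ℕ) :=
  (quadBlocks (crossQuads w)).image (Finset.image (spread q.entry))

/-- The blocks having two points over each of `u` and `v`. -/
def inflatePair (p : ℕ × ℕ) : Finset (Finset ℕ) :=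
  (quadBlocks pairQuads).image (Finset.image (spread fun i => if i = 0 then p.1 else p.2))

theorem inflateQuad_spec {n w : ℕ} {q : Quad} (hq : isIncreasing n q = true) (hw : w ≤ 4) :
    IsQuadPacking (inflateQuad w q) ∧ #(inflateQuad w q) = 16 * w := by
  have hlen : (crossQuads w).length = 16 * w := by simp [crossQuads]; ring
  rw [← hlen, ← card_quadBlocks (isPacking_crossQuads hw)]
  refine (isQuadPacking_quadBlocks (isPacking_crossQuads hw)).image
    (fun b hb x hx => lt_of_mem_quadBlocks (isPacking_crossQuads hw) hb hx)
    (spread_injOn (k := 4) fun i hi j hj hij => ?_)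
  obtain ⟨a, b, c, d⟩ := q
  rw [isIncreasing_iff] at hq
  simp only [Set.mem_Iio] at hi hj
  interval_cases i <;> interval_cases j <;> simp only [Quad.entry] at hij <;> omega

theorem inflatePair_spec {u v : ℕ} (h : u ≠ v) :
    IsQuadPacking (inflatePair (u, v)) ∧ #(inflatePair (u, v)) = 12 := by
  have hlen : pairQuads.length = 12 := rfl
  rw [← hlen, ← card_quadBlocks isPacking_pairQuads]
  refine (isQuadPacking_quadBlocks isPacking_pairQuads).image
    (fun b hb x hx => lt_of_mem_quadBlocks isPacking_pairQuads hb hx)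
    (spread_injOn (k := 2) fun i hi j hj hij => ?_)
  simp only [Set.mem_Iio] at hi hj hij
  interval_cases i <;> interval_cases j <;> simp at hij <;> omega

theorem exists_of_mem_inflateQuad {w a b c d : ℕ} (hw : w ≤ 4) {B : Finset ℕ}
    (h : B ∈ inflateQuad w (a, b, c, d)) : ∃ i < 4, ∃ j < 4, ∃ k < 4, ∃ s < w,
      B = {4 * a + i, 4 * b + j, 4 * c + k, 4 * d + s} := by
  simp only [inflateQuad, quadBlocks, crossQuads, mem_image, List.mem_toFinset, List.mem_map,
    List.mem_flatMap, List.mem_range] at h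
  obtain ⟨_, ⟨_, ⟨s, hs, r, hr, q, hq, rfl⟩, rfl⟩, rfl⟩ := h
  refine ⟨(12 - (q + r + s)) % 4, Nat.mod_lt _ (by norm_num), q, hq, r, hr, s, hs, ?_⟩
  have h1 : (12 - (q + r + s)) % 4 / 4 = 0 := by omega
  have h2 : (4 + q) / 4 = 1 := by omega
  have h3 : (8 + r) / 4 = 2 := by omega
  have h4 : (12 + s) / 4 = 3 := by omega
  have h5 : (4 + q) % 4 = q := by omega
  have h6 : (8 + r) % 4 = r := by omega
  have h7 : (12 + s) % 4 = s := by omega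
  simp only [Quad.points, image_insert, image_singleton, spread, h1, h2, h3, h4, h5, h6, h7,
    Quad.entry, Nat.mod_mod]

theorem exists_of_mem_inflatePair {u v : ℕ} {B : Finset ℕ} (h : B ∈ inflatePair (u, v)) :
    ∃ i < 4, ∃ i' < 4, ∃ j < 4, ∃ j' < 4, B = {4 * u + i, 4 * u + i', 4 * v + j, 4 * v + j'} := by
  simp only [inflatePair, quadBlocks, pairQuads, mem_image, List.mem_toFinset, List.mem_map,
    List.mem_cons, List.not_mem_nil, or_false] at h
  obtain ⟨_, ⟨⟨a, b, c, d⟩, hq, rfl⟩, rfl⟩ := h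
  obtain ⟨ha, hb, hc, hc', hd, hd'⟩ : a < 4 ∧ b < 4 ∧ 4 ≤ c ∧ c < 8 ∧ 4 ≤ d ∧ d < 8 := by
    simp only [Prod.mk.injEq] at hq
    omega
  refine ⟨a, ha, b, hb, c - 4, by omega, d - 4, by omega, ?_⟩
  have h1 : a / 4 = 0 ∧ b / 4 = 0 ∧ c / 4 = 1 ∧ d / 4 = 1 := by omega
  have h2 : a % 4 = a ∧ b % 4 = b ∧ c % 4 = c - 4 ∧ d % 4 = d - 4 := by omega
  simp [Quad.points, image_insert, spread, h1, h2]

theorem image_div_of_mem_inflateQuad {w : ℕ} {q : Quad} (hw : w ≤ 4) {B : Finset ℕ}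
    (h : B ∈ inflateQuad w q) : B.image (· / 4) = q.points := by
  obtain ⟨a, b, c, d⟩ := q
  obtain ⟨i, hi, j, hj, k, hk, s, hs, rfl⟩ := exists_of_mem_inflateQuad hw h
  have h1 : (4 * a + i) / 4 = a := by omega
  have h2 : (4 * b + j) / 4 = b := by omega
  have h3 : (4 * c + k) / 4 = c := by omega
  have h4 : (4 * d + s) / 4 = d := by omega
  simp only [image_insert, image_singleton, h1, h2, h3, h4, Quad.points]

theorem injOn_div_of_mem_inflateQuad {n w : ℕ} {q : Quad} (hq : isIncreasing n q = true)
    (hw : w ≤ 4) {B : Finset ℕ} (h : B ∈ inflateQuad w q) : Set.InjOn (· / 4) (B : Set ℕ) := by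
  rw [← card_image_iff, image_div_of_mem_inflateQuad hw h, card_points hq,
    (inflateQuad_spec hq hw).1.1 B h]

theorem image_div_of_mem_inflatePair {u v : ℕ} {B : Finset ℕ} (h : B ∈ inflatePair (u, v)) :
    B.image (· / 4) = {u, v} := by
  obtain ⟨i, hi, i', hi', j, hj, j', hj', rfl⟩ := exists_of_mem_inflatePair h
  have h1 : (4 * u + i) / 4 = u := by omega
  have h2 : (4 * u + i') / 4 = u := by omega
  have h3 : (4 * v + j) / 4 = v := by omega
  have h4 : (4 * v + j') / 4 = v := by omega
  simp [image_insert, h1, h2, h3, h4]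

theorem card_filter_div_of_mem_inflatePair {u v : ℕ} (huv : u ≠ v) {B : Finset ℕ}
    (h : B ∈ inflatePair (u, v)) (z : ℕ) : #{x ∈ B | x / 4 = z} ≤ 2 := by
  obtain ⟨i, hi, i', hi', j, hj, j', hj', rfl⟩ := exists_of_mem_inflatePair h
  by_cases hz : z = u
  · refine (card_le_card (t := {4 * u + i, 4 * u + i'}) fun x hx => ?_).trans card_le_two
    simp only [mem_filter, mem_insert, mem_singleton] at hx ⊢
    omega
  · refine (card_le_card (t := {4 * v + j, 4 * v + j'}) fun x hx => ?_).trans card_le_two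
    simp only [mem_filter, mem_insert, mem_singleton] at hx ⊢
    omega

/-- A subset of a block over a pair that meets only one fibre has at most two points. -/
theorem card_le_two_of_mem_inflatePair {u v : ℕ} (huv : u ≠ v) {B S : Finset ℕ}
    (h : B ∈ inflatePair (u, v)) (hS : S ⊆ B) (h1 : #(S.image (· / 4)) ≤ 1) : #S ≤ 2 := by
  refine (card_le_mul_card_image (f := (· / 4)) S 2 fun z _ => ?_).trans (by omega)
  exact (card_le_card (filter_subset_filter _ hS)).trans
    (card_filter_div_of_mem_inflatePair huv h z)

end Inflation

section Candelabra

/-- Whether an increasing quadruple has at most two points in the union of any of the groups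
`{12 * i, …, 12 * i + 11}`, `i < m`, and the stem `{12 * m, …, 12 * m + 5}`. -/
def isDispersed (m : ℕ) : Quad → Bool
  | (a, b, c, d) =>
    Nat.blt c (Nat.mul 12 m) && Nat.blt (Nat.div a 12) (Nat.div c 12) &&
      Nat.blt (Nat.div b 12) (Nat.div d 12) &&
      (Nat.blt d (Nat.mul 12 m) ||
        Nat.blt (Nat.div a 12) (Nat.div b 12) && Nat.blt (Nat.div b 12) (Nat.div c 12))

theorem card_filter_points_le {n m : ℕ} {q : Quad} (hq : isIncreasing n q = true)
    (h : isDispersed m q = true) (i : ℕ) :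
    #{y ∈ q.points | y / 12 = i ∨ 12 * m ≤ y} ≤ 2 := by
  obtain ⟨a, b, c, d⟩ := q
  rw [isIncreasing_iff] at hq
  have h' : ((c < 12 * m ∧ a / 12 < c / 12) ∧ b / 12 < d / 12) ∧
      (d < 12 * m ∨ a / 12 < b / 12 ∧ b / 12 < c / 12) := by
    simp only [isDispersed, Bool.and_eq_true, Bool.or_eq_true, Nat.blt_eq] at h
    exact h
  have h1 : a ∉ ({b, c, d} : Finset ℕ) := by simp; omega
  have h2 : b ∉ ({c, d} : Finset ℕ) := by simp; omega
  have h3 : c ∉ ({d} : Finset ℕ) := by simp; omega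
  rw [Quad.points, card_filter, sum_insert h1, sum_insert h2, sum_insert h3, sum_singleton]
  split_ifs <;> omega

/-- The number of points over the point `y`, one of the points over `12 * m + 5` being removed. -/
def weight (m y : ℕ) : ℕ := bif Nat.beq y (Nat.add (Nat.mul 12 m) 5) then 3 else 4

theorem weight_le (m y : ℕ) : weight m y ≤ 4 := by
  unfold weight
  cases Nat.beq y (Nat.add (Nat.mul 12 m) 5) <;> simp

theorem weight_last (m : ℕ) : weight m (12 * m + 5) = 3 := by
  have : Nat.beq (12 * m + 5) (Nat.add (Nat.mul 12 m) 5) = true := Nat.beq_refl _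
  rw [weight, this, cond_true]

/-- The pairs of points in different groups. -/
def crossPairs (m : ℕ) : Finset (ℕ × ℕ) :=
  {p ∈ range (12 * m) ×ˢ range (12 * m) | p.1 / 12 < p.2 / 12}

/-- Inflation of a candelabra system of type `(12^m : 6)` to one of type `(48^m : 24)` with a stem
point removed. -/
def inflation (m : ℕ) (l : List Quad) : Finset (Finset ℕ) :=
  (l.toFinset.biUnion fun q => inflateQuad (weight m q.2.2.2) q) ∪
    (crossPairs m).biUnion inflatePair

variable {m : ℕ} {l : List Quad}

theorem mem_crossPairs {p : ℕ × ℕ} :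
    p ∈ crossPairs m ↔ (p.1 < 12 * m ∧ p.2 < 12 * m) ∧ p.1 / 12 < p.2 / 12 := by
  simp [crossPairs]

theorem inflation_spec (h : isPacking (12 * m + 6) l 0 = true) :
    IsQuadPacking (inflation m l) ∧ #(inflation m l) =
      (l.map fun q => 16 * weight m q.2.2.2).sum + 12 * #(crossPairs m) := by
  have hinc : ∀ q ∈ l.toFinset, isIncreasing (12 * m + 6) q = true := fun q hq =>
    isIncreasing_of_isPacking h (List.mem_toFinset.1 hq)
  have hne : ∀ p ∈ crossPairs m, p.1 ≠ p.2 := fun p hp e => by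
    have := (mem_crossPairs.1 hp).2
    rw [e] at this
    exact lt_irrefl _ this
  obtain ⟨hA, hA'⟩ := IsQuadPacking.biUnion (I := l.toFinset)
    (F := fun q => inflateQuad (weight m q.2.2.2) q)
    (fun q hq => (inflateQuad_spec (hinc q hq) (weight_le _ _)).1)
    fun q hq r hr hqr b hb b' hb' => by
      refine (card_inter_le_of_injOn
        (injOn_div_of_mem_inflateQuad (hinc q hq) (weight_le _ _) hb)).trans ?_
      rw [image_div_of_mem_inflateQuad (weight_le _ _) hb,
        image_div_of_mem_inflateQuad (weight_le _ _) hb']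
      exact card_inter_points_le h (List.mem_toFinset.1 hq) (List.mem_toFinset.1 hr) hqr
  obtain ⟨hB, hB'⟩ := IsQuadPacking.biUnion (I := crossPairs m) (F := inflatePair)
    (fun p hp => (inflatePair_spec (hne p hp)).1) fun p hp p' hp' hpp b hb b' hb' => by
      obtain ⟨u, v⟩ := p
      obtain ⟨u', v'⟩ := p'
      refine card_le_two_of_mem_inflatePair (hne _ hp) hb inter_subset_left ?_
      refine card_le_one.2 fun x hx y hy => ?_
      have hsub : (b ∩ b').image (· / 4) ⊆ {u, v} ∩ {u', v'} := by
        rw [← image_div_of_mem_inflatePair hb, ← image_div_of_mem_inflatePair hb']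
        exact image_inter_subset _ _ _
      have hx := hsub hx
      have hy := hsub hy
      have h1 := (mem_crossPairs.1 hp).2
      have h2 := (mem_crossPairs.1 hp').2
      simp only [mem_inter, mem_insert, mem_singleton, ne_eq, Prod.mk.injEq] at hx hy hpp h1 h2
      by_contra hxy
      have : (u < v ∧ u' < v') := ⟨by omega, by omega⟩
      omega
  obtain ⟨hC, hC'⟩ := hA.union hB fun a ha b hb => by
    obtain ⟨q, hq, ha⟩ := mem_biUnion.1 ha
    obtain ⟨⟨u, v⟩, hp, hb⟩ := mem_biUnion.1 hb
    refine (card_inter_le_of_injOn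
      (injOn_div_of_mem_inflateQuad (hinc q hq) (weight_le _ _) ha)).trans ?_
    rw [image_div_of_mem_inflatePair hb]
    exact (card_le_card inter_subset_right).trans card_le_two
  refine ⟨hC, ?_⟩
  rw [inflation, hC', hA', hB', sum_congr rfl fun q hq =>
    (inflateQuad_spec (hinc q hq) (weight_le m q.2.2.2)).2, sum_congr rfl fun p hp =>
    (inflatePair_spec (hne p hp)).2, sum_const, smul_eq_mul, mul_comm _ 12,
    List.sum_toFinset _ (nodup_map_points h).of_map]

theorem lt_of_mem_inflation (h : isPacking (12 * m + 6) l 0 = true) {b : Finset ℕ}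
    (hb : b ∈ inflation m l) {x : ℕ} (hx : x ∈ b) : x < 48 * m + 23 := by
  rcases mem_union.1 hb with hb | hb
  · obtain ⟨⟨a, b, c, d⟩, hq, hb⟩ := mem_biUnion.1 hb
    have hinc := isIncreasing_iff.1 (isIncreasing_of_isPacking h (List.mem_toFinset.1 hq))
    obtain ⟨i, hi, j, hj, k, hk, s, hs, rfl⟩ := exists_of_mem_inflateQuad (weight_le _ _) hb
    have hs4 : s < 4 := hs.trans_le (weight_le m d)
    simp only [mem_insert, mem_singleton] at hx
    by_cases hd : d = 12 * m + 5
    · rw [hd, weight_last] at hs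
      omega
    · omega
  · obtain ⟨⟨u, v⟩, hp, hb⟩ := mem_biUnion.1 hb
    have := (mem_crossPairs.1 hp).1
    obtain ⟨i, hi, i', hi', j, hj, j', hj', rfl⟩ := exists_of_mem_inflatePair hb
    simp only [mem_insert, mem_singleton] at hx this
    omega

theorem card_filter_inflation_le (h : isPacking (12 * m + 6) l 0 = true)
    (hl : l.all (isDispersed m) = true) {b : Finset ℕ} (hb : b ∈ inflation m l) (i : ℕ) :
    #{x ∈ b | x / 48 = i ∨ 48 * m ≤ x} ≤ 2 := by
  have himage : ({x ∈ b | x / 48 = i ∨ 48 * m ≤ x} : Finset ℕ).image (· / 4) ⊆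
      {y ∈ b.image (· / 4) | y / 12 = i ∨ 12 * m ≤ y} := fun y hy => by
    obtain ⟨x, hx, rfl⟩ := mem_image.1 hy
    obtain ⟨hx, hx'⟩ := mem_filter.1 hx
    exact mem_filter.2 ⟨mem_image_of_mem _ hx, by omega⟩
  rcases mem_union.1 hb with hb | hb
  · obtain ⟨q, hq, hb⟩ := mem_biUnion.1 hb
    have hq := List.mem_toFinset.1 hq
    have hinc := isIncreasing_of_isPacking h hq
    rw [image_div_of_mem_inflateQuad (weight_le _ _) hb] at himage
    rw [← card_image_of_injOn ((injOn_div_of_mem_inflateQuad hinc (weight_le _ _) hb).mono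
      (coe_subset.2 (filter_subset _ _)))]
    exact (card_le_card himage).trans (card_filter_points_le hinc (List.all_eq_true.1 hl q hq) i)
  · obtain ⟨⟨u, v⟩, hp, hb⟩ := mem_biUnion.1 hb
    have hp := mem_crossPairs.1 hp
    refine card_le_two_of_mem_inflatePair (by rintro rfl; exact lt_irrefl _ hp.2) hb
      (filter_subset _ _) ((card_le_card himage).trans (card_le_one.2 fun x hx y hy => ?_))
    rw [image_div_of_mem_inflatePair hb] at hx hy
    simp only [mem_filter, mem_insert, mem_singleton] at hx hy hp
    omega

end Candelabra

section Data

/-- The pair `(min a b, max a b)`, in terms of truncated subtraction. -/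
def sortPair (a b : ℕ) : ℕ × ℕ := (Nat.sub a (Nat.sub a b), Nat.add b (Nat.sub a b))

/-- Sort a quadruple with a sorting network. -/
def sortQuad : Quad → Quad
  | (a, b, c, d) =>
    match sortPair a b, sortPair c d with
    | (a, b), (c, d) =>
      match sortPair a c, sortPair b d with
      | (a, c), (b, d) =>
        match sortPair b c with
        | (b, c) => (a, b, c, d)

/-- The image of a point under a permutation packed with 7 bits for each image. -/
def permuteEntry (g a : ℕ) : ℕ := Nat.mod (Nat.shiftRight g (Nat.mul 7 a)) 128

/-- Apply a packed permutation to a quadruple. -/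
def permute (g : ℕ) : Quad → Quad
  | (a, b, c, d) =>
    (permuteEntry g a, permuteEntry g b, permuteEntry g c, permuteEntry g d)

/-- The blocks of an optimal packing quadruple system on 23 points. -/
def stemQuads : List Quad :=
  [(0, 1, 3, 8), (0, 1, 4, 5), (0, 1, 6, 7), (0, 1, 9, 19), (0, 1, 10, 20), (0, 1, 11, 22),
    (0, 1, 12, 21), (0, 1, 13, 15), (0, 1, 14, 16), (0, 2, 3, 5), (0, 2, 4, 7), (0, 2, 6, 8),
    (0, 2, 9, 17), (0, 2, 10, 18), (0, 2, 11, 14), (0, 2, 12, 13), (0, 2, 15, 21), (0, 2, 16, 22),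
    (0, 3, 4, 6), (0, 3, 9, 12), (0, 3, 10, 11), (0, 3, 15, 19), (0, 3, 16, 20), (0, 3, 17, 21),
    (0, 3, 18, 22), (0, 4, 9, 16), (0, 4, 10, 15), (0, 4, 11, 20), (0, 4, 12, 19), (0, 4, 13, 18),
    (0, 4, 14, 17), (0, 5, 7, 8), (0, 5, 9, 11), (0, 5, 10, 12), (0, 5, 13, 14), (0, 5, 15, 22),
    (0, 5, 16, 21), (0, 5, 17, 20), (0, 5, 18, 19), (0, 6, 9, 13), (0, 6, 10, 14), (0, 6, 11, 21),
    (0, 6, 12, 22), (0, 6, 15, 18), (0, 6, 16, 17), (0, 6, 19, 20), (0, 7, 9, 22), (0, 7, 10, 21),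
    (0, 7, 11, 15), (0, 7, 12, 16), (0, 7, 13, 20), (0, 7, 14, 19), (0, 7, 17, 18), (0, 8, 9, 18),
    (0, 8, 10, 17), (0, 8, 11, 19), (0, 8, 12, 20), (0, 8, 13, 16), (0, 8, 14, 15),
    (0, 8, 21, 22), (0, 9, 14, 21), (0, 9, 15, 20), (0, 10, 13, 22), (0, 10, 16, 19),
    (0, 11, 13, 17), (0, 11, 16, 18), (0, 12, 14, 18), (0, 12, 15, 17), (0, 13, 19, 21),
    (0, 14, 20, 22), (0, 17, 19, 22), (0, 18, 20, 21), (1, 2, 3, 6), (1, 2, 4, 8), (1, 2, 5, 7),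
    (1, 2, 11, 15), (1, 2, 12, 16), (1, 2, 13, 22), (1, 2, 14, 21), (1, 2, 17, 19),
    (1, 2, 18, 20), (1, 3, 4, 7), (1, 3, 9, 20), (1, 3, 10, 19), (1, 3, 11, 17), (1, 3, 12, 18),
    (1, 3, 13, 21), (1, 3, 14, 22), (1, 3, 15, 16), (1, 4, 9, 10), (1, 4, 11, 14), (1, 4, 12, 13),
    (1, 4, 15, 19), (1, 4, 16, 20), (1, 4, 17, 22), (1, 4, 18, 21), (1, 5, 6, 8), (1, 5, 9, 22),
    (1, 5, 10, 21), (1, 5, 11, 18), (1, 5, 12, 17), (1, 5, 13, 19), (1, 5, 14, 20), (1, 6, 9, 16),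
    (1, 6, 10, 15), (1, 6, 11, 20), (1, 6, 12, 19), (1, 6, 13, 18), (1, 6, 14, 17), (1, 7, 9, 18),
    (1, 7, 10, 17), (1, 7, 11, 19), (1, 7, 12, 20), (1, 7, 13, 16), (1, 7, 14, 15),
    (1, 7, 21, 22), (1, 8, 9, 13), (1, 8, 10, 14), (1, 8, 11, 16), (1, 8, 12, 15), (1, 8, 17, 18),
    (1, 8, 19, 21), (1, 8, 20, 22), (1, 9, 11, 21), (1, 9, 12, 14), (1, 9, 15, 17),
    (1, 10, 11, 13), (1, 10, 12, 22), (1, 10, 16, 18), (1, 13, 17, 20), (1, 14, 18, 19),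
    (1, 15, 18, 22), (1, 15, 20, 21), (1, 16, 17, 21), (1, 16, 19, 22), (2, 3, 7, 8),
    (2, 3, 9, 10), (2, 3, 11, 13), (2, 3, 12, 14), (2, 3, 15, 18), (2, 3, 16, 17), (2, 3, 19, 21),
    (2, 3, 20, 22), (2, 4, 5, 6), (2, 4, 9, 20), (2, 4, 10, 19), (2, 4, 11, 17), (2, 4, 12, 18),
    (2, 4, 13, 21), (2, 4, 14, 22), (2, 4, 15, 16), (2, 5, 9, 15), (2, 5, 10, 16), (2, 5, 11, 22),
    (2, 5, 12, 21), (2, 5, 13, 18), (2, 5, 14, 17), (2, 5, 19, 20), (2, 6, 9, 11), (2, 6, 10, 12),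
    (2, 6, 13, 14), (2, 6, 15, 22), (2, 6, 16, 21), (2, 6, 17, 20), (2, 6, 18, 19), (2, 7, 9, 12),
    (2, 7, 10, 11), (2, 7, 15, 19), (2, 7, 16, 20), (2, 7, 17, 21), (2, 7, 18, 22), (2, 8, 9, 22),
    (2, 8, 10, 21), (2, 8, 11, 18), (2, 8, 12, 17), (2, 8, 13, 19), (2, 8, 14, 20),
    (2, 9, 13, 16), (2, 9, 14, 19), (2, 9, 18, 21), (2, 10, 13, 20), (2, 10, 14, 15),
    (2, 10, 17, 22), (2, 11, 16, 19), (2, 11, 20, 21), (2, 12, 15, 20), (2, 12, 19, 22),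
    (2, 13, 15, 17), (2, 14, 16, 18), (3, 4, 5, 8), (3, 4, 9, 17), (3, 4, 10, 18), (3, 4, 11, 12),
    (3, 4, 13, 20), (3, 4, 14, 19), (3, 4, 15, 22), (3, 4, 16, 21), (3, 5, 6, 7), (3, 5, 9, 13),
    (3, 5, 10, 14), (3, 5, 11, 16), (3, 5, 12, 15), (3, 5, 17, 19), (3, 5, 18, 20),
    (3, 5, 21, 22), (3, 6, 9, 15), (3, 6, 10, 16), (3, 6, 11, 19), (3, 6, 12, 20), (3, 6, 13, 22),
    (3, 6, 14, 21), (3, 6, 17, 18), (3, 7, 9, 21), (3, 7, 10, 22), (3, 7, 11, 18), (3, 7, 12, 17),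
    (3, 7, 13, 14), (3, 7, 15, 20), (3, 7, 16, 19), (3, 8, 9, 11), (3, 8, 10, 12), (3, 8, 13, 15),
    (3, 8, 14, 16), (3, 8, 17, 22), (3, 8, 18, 21), (3, 8, 19, 20), (3, 9, 14, 18),
    (3, 9, 19, 22), (3, 10, 13, 17), (3, 10, 20, 21), (3, 11, 14, 20), (3, 11, 15, 21),
    (3, 12, 13, 19), (3, 12, 16, 22), (3, 13, 16, 18), (3, 14, 15, 17), (4, 5, 9, 14),
    (4, 5, 10, 13), (4, 5, 11, 15), (4, 5, 12, 16), (4, 5, 17, 18), (4, 5, 19, 21),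
    (4, 5, 20, 22), (4, 6, 7, 8), (4, 6, 9, 12), (4, 6, 10, 11), (4, 6, 13, 17), (4, 6, 14, 18),
    (4, 6, 15, 20), (4, 6, 16, 19), (4, 6, 21, 22), (4, 7, 9, 13), (4, 7, 10, 14), (4, 7, 11, 22),
    (4, 7, 12, 21), (4, 7, 15, 17), (4, 7, 16, 18), (4, 7, 19, 20), (4, 8, 9, 19), (4, 8, 10, 20),
    (4, 8, 11, 21), (4, 8, 12, 22), (4, 8, 13, 14), (4, 8, 15, 18), (4, 8, 16, 17),
    (4, 9, 15, 21), (4, 9, 18, 22), (4, 10, 16, 22), (4, 10, 17, 21), (4, 11, 13, 16),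
    (4, 11, 18, 19), (4, 12, 14, 15), (4, 12, 17, 20), (4, 13, 19, 22), (4, 14, 20, 21),
    (5, 6, 9, 19), (5, 6, 10, 20), (5, 6, 11, 12), (5, 6, 13, 16), (5, 6, 14, 15), (5, 6, 17, 22),
    (5, 6, 18, 21), (5, 7, 9, 10), (5, 7, 11, 14), (5, 7, 12, 13), (5, 7, 15, 18), (5, 7, 16, 17),
    (5, 7, 19, 22), (5, 7, 20, 21), (5, 8, 9, 21), (5, 8, 10, 22), (5, 8, 11, 20), (5, 8, 12, 19),
    (5, 8, 13, 17), (5, 8, 14, 18), (5, 8, 15, 16), (5, 9, 12, 18), (5, 9, 16, 20),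
    (5, 10, 11, 17), (5, 10, 15, 19), (5, 11, 13, 21), (5, 12, 14, 22), (5, 13, 15, 20),
    (5, 14, 16, 19), (5, 15, 17, 21), (5, 16, 18, 22), (6, 7, 9, 17), (6, 7, 10, 18),
    (6, 7, 11, 13), (6, 7, 12, 14), (6, 7, 15, 16), (6, 7, 19, 21), (6, 7, 20, 22), (6, 8, 9, 10),
    (6, 8, 11, 17), (6, 8, 12, 18), (6, 8, 13, 20), (6, 8, 14, 19), (6, 8, 15, 21),
    (6, 8, 16, 22), (6, 9, 14, 22), (6, 9, 20, 21), (6, 10, 13, 21), (6, 10, 19, 22),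
    (6, 11, 14, 16), (6, 11, 18, 22), (6, 12, 13, 15), (6, 12, 17, 21), (6, 15, 17, 19),
    (6, 16, 18, 20), (7, 8, 9, 15), (7, 8, 10, 16), (7, 8, 11, 12), (7, 8, 13, 21),
    (7, 8, 14, 22), (7, 8, 17, 19), (7, 8, 18, 20), (7, 9, 11, 20), (7, 9, 14, 16),
    (7, 10, 12, 19), (7, 10, 13, 15), (7, 11, 16, 21), (7, 12, 15, 22), (7, 13, 17, 22),
    (7, 13, 18, 19), (7, 14, 17, 20), (7, 14, 18, 21), (8, 9, 12, 16), (8, 9, 14, 17),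
    (8, 10, 11, 15), (8, 10, 13, 18), (8, 11, 13, 22), (8, 12, 14, 21), (8, 15, 17, 20),
    (8, 15, 19, 22), (8, 16, 18, 19), (8, 16, 20, 21), (9, 10, 11, 18), (9, 10, 12, 17),
    (9, 10, 13, 19), (9, 10, 14, 20), (9, 10, 15, 16), (9, 11, 12, 13), (9, 11, 14, 15),
    (9, 11, 16, 22), (9, 11, 17, 19), (9, 12, 19, 20), (9, 12, 21, 22), (9, 13, 15, 22),
    (9, 13, 17, 21), (9, 13, 18, 20), (9, 15, 18, 19), (9, 16, 17, 18), (9, 16, 19, 21),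
    (9, 17, 20, 22), (10, 11, 12, 14), (10, 11, 19, 20), (10, 11, 21, 22), (10, 12, 13, 16),
    (10, 12, 15, 21), (10, 12, 18, 20), (10, 14, 16, 21), (10, 14, 17, 19), (10, 14, 18, 22),
    (10, 15, 17, 18), (10, 15, 20, 22), (10, 16, 17, 20), (10, 18, 19, 21), (11, 12, 15, 18),
    (11, 12, 16, 17), (11, 12, 19, 21), (11, 12, 20, 22), (11, 13, 14, 18), (11, 13, 15, 19),
    (11, 14, 17, 21), (11, 14, 19, 22), (11, 15, 16, 20), (11, 15, 17, 22), (11, 17, 18, 20),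
    (12, 13, 14, 17), (12, 13, 18, 22), (12, 13, 20, 21), (12, 14, 16, 20), (12, 15, 16, 19),
    (12, 16, 18, 21), (12, 17, 18, 19), (13, 14, 15, 16), (13, 14, 19, 20), (13, 14, 21, 22),
    (13, 15, 18, 21), (13, 16, 17, 19), (13, 16, 20, 22), (14, 15, 18, 20), (14, 15, 19, 21),
    (14, 16, 17, 22), (15, 16, 21, 22), (17, 18, 21, 22), (17, 19, 20, 21), (18, 19, 20, 22)]

/-- The blocks of a holey packing quadruple system on 17 points whose hole is `{12, …, 16}`. -/
def holeQuads : List Quad :=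
  [(0, 1, 2, 10), (0, 1, 3, 6), (0, 1, 4, 13), (0, 1, 5, 16), (0, 1, 7, 9), (0, 1, 12, 14),
    (0, 2, 3, 9), (0, 2, 4, 11), (0, 2, 5, 7), (0, 2, 6, 8), (0, 2, 12, 15), (0, 2, 13, 16),
    (0, 3, 4, 14), (0, 3, 5, 10), (0, 3, 7, 15), (0, 3, 8, 16), (0, 3, 11, 13), (0, 4, 6, 10),
    (0, 4, 7, 16), (0, 4, 8, 12), (0, 4, 9, 15), (0, 5, 6, 11), (0, 5, 8, 15), (0, 5, 9, 14),
    (0, 5, 12, 13), (0, 6, 9, 12), (0, 6, 13, 15), (0, 6, 14, 16), (0, 7, 8, 10), (0, 7, 11, 12),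
    (0, 7, 13, 14), (0, 8, 9, 13), (0, 8, 11, 14), (0, 9, 10, 11), (0, 10, 12, 16),
    (0, 10, 14, 15), (0, 11, 15, 16), (1, 2, 3, 4), (1, 2, 6, 14), (1, 2, 7, 8), (1, 2, 9, 13),
    (1, 2, 11, 12), (1, 2, 15, 16), (1, 3, 5, 7), (1, 3, 8, 10), (1, 3, 9, 11), (1, 3, 12, 15),
    (1, 3, 13, 16), (1, 4, 5, 11), (1, 4, 6, 7), (1, 4, 8, 15), (1, 4, 9, 14), (1, 4, 10, 12),
    (1, 5, 6, 13), (1, 5, 8, 14), (1, 5, 9, 12), (1, 5, 10, 15), (1, 6, 8, 11), (1, 6, 9, 15),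
    (1, 6, 10, 16), (1, 7, 10, 11), (1, 7, 12, 16), (1, 7, 14, 15), (1, 8, 9, 16), (1, 8, 12, 13),
    (1, 10, 13, 14), (1, 11, 13, 15), (1, 11, 14, 16), (2, 3, 5, 11), (2, 3, 6, 13),
    (2, 3, 7, 16), (2, 3, 12, 14), (2, 4, 5, 6), (2, 4, 7, 9), (2, 4, 8, 10), (2, 4, 12, 16),
    (2, 4, 14, 15), (2, 5, 8, 12), (2, 5, 9, 15), (2, 5, 10, 16), (2, 5, 13, 14), (2, 6, 9, 16),
    (2, 6, 10, 12), (2, 6, 11, 15), (2, 7, 10, 15), (2, 7, 11, 14), (2, 7, 12, 13), (2, 8, 9, 11),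
    (2, 8, 13, 15), (2, 8, 14, 16), (2, 9, 10, 14), (2, 10, 11, 13), (3, 4, 6, 8), (3, 4, 7, 13),
    (3, 4, 9, 10), (3, 4, 11, 12), (3, 4, 15, 16), (3, 5, 6, 12), (3, 5, 8, 9), (3, 5, 13, 15),
    (3, 5, 14, 16), (3, 6, 7, 9), (3, 6, 10, 15), (3, 6, 11, 14), (3, 7, 8, 12), (3, 7, 10, 14),
    (3, 8, 11, 15), (3, 8, 13, 14), (3, 9, 12, 16), (3, 9, 14, 15), (3, 10, 11, 16),
    (3, 10, 12, 13), (4, 5, 7, 10), (4, 5, 8, 13), (4, 5, 9, 16), (4, 5, 12, 14), (4, 6, 9, 11),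
    (4, 6, 12, 15), (4, 6, 13, 16), (4, 7, 8, 14), (4, 7, 11, 15), (4, 8, 11, 16), (4, 9, 12, 13),
    (4, 10, 13, 15), (4, 10, 14, 16), (4, 11, 13, 14), (5, 6, 7, 8), (5, 6, 10, 14),
    (5, 6, 15, 16), (5, 7, 9, 11), (5, 7, 12, 15), (5, 7, 13, 16), (5, 8, 10, 11), (5, 9, 10, 13),
    (5, 11, 12, 16), (5, 11, 14, 15), (6, 7, 10, 13), (6, 7, 11, 16), (6, 7, 12, 14),
    (6, 8, 9, 10), (6, 8, 12, 16), (6, 8, 14, 15), (6, 9, 13, 14), (6, 11, 12, 13),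
    (7, 8, 11, 13), (7, 8, 15, 16), (7, 9, 10, 12), (7, 9, 13, 15), (7, 9, 14, 16),
    (8, 9, 12, 14), (8, 10, 12, 15), (8, 10, 13, 16), (9, 10, 15, 16), (9, 11, 12, 15),
    (9, 11, 13, 16), (10, 11, 12, 14)]

/-- Representatives of the block orbits on which `perms₂ * perms₃` acts regularly. -/
def regularBases : List Quad :=
  [(0, 1, 12, 45), (0, 1, 14, 19), (0, 1, 16, 20), (0, 2, 12, 28), (0, 2, 13, 44),
    (0, 2, 14, 43), (0, 2, 15, 23), (0, 2, 17, 52), (0, 2, 18, 65), (0, 2, 21, 54),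
    (0, 2, 22, 58), (0, 2, 48, 61), (0, 3, 12, 54), (0, 3, 13, 42), (0, 3, 14, 21),
    (0, 3, 16, 23), (0, 3, 17, 18), (0, 3, 19, 57), (0, 3, 20, 63), (0, 3, 22, 59),
    (0, 3, 48, 62), (0, 6, 12, 17), (0, 6, 13, 57), (0, 6, 14, 54), (0, 6, 15, 16),
    (0, 6, 18, 48), (0, 6, 21, 58), (0, 6, 60, 62), (0, 7, 12, 50), (0, 7, 13, 27),
    (0, 7, 15, 46), (0, 7, 16, 64), (0, 7, 18, 59), (0, 7, 19, 33), (0, 7, 21, 45),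
    (0, 7, 22, 61), (0, 7, 48, 57), (0, 8, 12, 20), (0, 8, 13, 64), (0, 8, 14, 17),
    (0, 8, 15, 49), (0, 8, 16, 32), (0, 8, 22, 34), (0, 8, 50, 57), (0, 8, 56, 61),
    (0, 9, 12, 16), (0, 9, 13, 20), (0, 9, 14, 41), (0, 9, 15, 29), (0, 9, 18, 51),
    (0, 9, 19, 62), (0, 9, 50, 63), (0, 9, 52, 56), (0, 10, 12, 41), (0, 10, 14, 42),
    (0, 10, 16, 17), (0, 10, 18, 52), (0, 10, 22, 60), (0, 10, 48, 59), (0, 10, 50, 65),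
    (0, 11, 13, 30), (0, 11, 14, 15), (0, 11, 16, 55), (0, 11, 17, 63), (0, 11, 19, 32),
    (0, 11, 48, 50), (0, 11, 56, 65), (0, 12, 13, 29), (0, 12, 14, 34), (0, 12, 15, 33),
    (0, 12, 24, 26), (0, 12, 27, 57), (0, 12, 30, 51), (0, 12, 32, 47), (0, 12, 38, 46),
    (0, 12, 40, 66), (0, 12, 42, 64), (0, 12, 44, 68), (0, 12, 49, 55), (0, 12, 53, 58),
    (0, 12, 56, 63), (0, 12, 60, 67), (0, 12, 62, 69), (0, 12, 65, 70), (0, 13, 14, 51),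
    (0, 13, 24, 50), (0, 13, 31, 40), (0, 13, 32, 61), (0, 13, 33, 67), (0, 13, 35, 69),
    (0, 13, 41, 59), (0, 13, 49, 70), (0, 13, 52, 58), (0, 13, 53, 65), (0, 13, 55, 56),
    (0, 13, 60, 68), (0, 13, 62, 66), (0, 14, 16, 49), (0, 14, 26, 47), (0, 14, 27, 67),
    (0, 14, 28, 68), (0, 14, 30, 46), (0, 14, 48, 56), (0, 14, 50, 58), (0, 14, 52, 64),
    (0, 14, 53, 57), (0, 14, 59, 63), (0, 14, 60, 65), (0, 14, 61, 70), (0, 15, 26, 57),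
    (0, 15, 30, 60), (0, 15, 31, 48), (0, 15, 34, 54), (0, 15, 50, 51), (0, 15, 53, 67),
    (0, 15, 56, 70), (0, 15, 59, 69), (0, 15, 62, 64), (0, 16, 29, 67), (0, 16, 30, 58),
    (0, 16, 31, 62), (0, 16, 46, 70), (0, 16, 48, 54), (0, 16, 56, 66), (0, 16, 57, 68),
    (0, 16, 60, 63), (0, 17, 30, 68), (0, 17, 48, 55), (0, 17, 49, 60), (0, 17, 50, 53),
    (0, 17, 56, 59), (0, 17, 57, 64), (0, 17, 61, 65), (0, 18, 30, 45), (0, 18, 33, 57),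
    (0, 18, 47, 64), (0, 18, 53, 68), (0, 18, 54, 60), (0, 18, 58, 69), (0, 20, 49, 59),
    (0, 20, 50, 60), (0, 20, 51, 66), (0, 20, 52, 57), (0, 20, 54, 65), (0, 20, 56, 64),
    (0, 20, 61, 67), (0, 20, 62, 68), (0, 21, 49, 68), (0, 21, 52, 66), (0, 21, 55, 70),
    (0, 21, 57, 67), (6, 8, 13, 63), (6, 8, 14, 58), (6, 8, 17, 54), (6, 8, 52, 65),
    (6, 9, 12, 48), (6, 9, 15, 65), (6, 9, 17, 50), (6, 9, 52, 61), (6, 12, 24, 46),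
    (6, 12, 29, 61), (6, 12, 40, 59), (6, 12, 51, 62), (6, 12, 55, 68), (6, 12, 56, 69),
    (6, 14, 48, 67), (6, 14, 49, 66), (6, 14, 52, 68), (6, 15, 48, 49), (6, 15, 50, 52),
    (6, 15, 53, 61), (6, 15, 55, 66), (6, 15, 57, 70), (6, 15, 58, 63), (6, 15, 59, 62),
    (6, 15, 60, 68), (6, 15, 64, 67)]

/-- Representatives of the remaining block orbits of `perms₃` on the blocks with a stabiliser of
order 2. -/
def bases₃ : List Quad :=
  [(0, 1, 48, 64), (18, 19, 49, 65), (18, 19, 58, 62), (18, 19, 59, 64), (0, 1, 50, 59),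
    (18, 19, 48, 57), (18, 19, 51, 55), (18, 19, 53, 56), (0, 1, 52, 61), (18, 19, 50, 60),
    (18, 19, 52, 61), (18, 19, 54, 63), (6, 7, 48, 62), (12, 13, 49, 64), (12, 13, 58, 65),
    (12, 13, 59, 62), (6, 7, 50, 59), (12, 13, 48, 57), (12, 13, 51, 55), (12, 13, 53, 56),
    (6, 7, 52, 63), (12, 13, 50, 61), (12, 13, 52, 63), (12, 13, 54, 60)]

/-- Representatives of the remaining block orbits of `perms₂` on the blocks with a stabiliser of
order 3. -/
def bases₂ : List Quad :=
  [(0, 18, 28, 70), (2, 20, 32, 70), (4, 22, 34, 70), (0, 20, 34, 70), (0, 23, 43, 70),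
    (0, 33, 45, 70), (6, 14, 46, 70), (6, 17, 27, 70), (6, 29, 40, 70)]

/-- A group of order 8 of permutations of 71 points, packed with 7 bits for each image. -/
def perms₂ : List ℕ :=
  [225503511637336514062769260455550009796436009263413749408805389136078905358679646276562308967426390762866821681519944441696107891347690951477441888384,
    225503511637336514062769260455550009796436009263411545204718259621712397042791563845160271856366573978157194090486272723739625481643620165862975127553,
    225428396122861396810259891228865365926294401251010727972575570630054910426801392366469308894004508614086856318533559178142074559397481731569513812901,
    225453176514362288673717609547521385105831743766178044866875043712665702407933523625334254513439677969171040456214992983759266349455169374175539777054,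
    225428396122861396810259891228865365926294401251011830074619135387238164584773483991280297665221456436821457679789715372263651308738484747690524201639,
    225453176514362288673717609547521385105831743766179129882065219868962394485825723833758214387188944925058780955688614527409656930705419603970106068764,
    225478731245835622199311076735416213135276676584343816425205458362181255602099262781442642663383640544541496951701326599730768051774287766835907856786,
    225478731245835622199311076735416213135276676584344892896968972044794422712317059199716965737015271157612521023933849151687457430344096146930964711699]

/-- A group of order 9 of permutations of 71 points, packed with 7 bits for each image. -/
def perms₃ : List ℕ :=
  [225503511637336514062769260455550009796436009263413749408805389136078905358679646276562308967426390762866821681519944441696107891347690951477441888384,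
    225503511637058117885502747658827565607903320635357364627560522464882419860888652381189819729625886050489816468864704348830923702877640625847485399426,
    225478345588137659785101076946754064299532234056611862332078178675530877932343608462371618991688418106392891662655374252358843587424478360215757029504,
    225503511637242013804505449102699438845326570625027756802483743776114793642381128979573275061613763970305706106409986776825575503905929462304775078532,
    225478345588232160043364888299604635250641672694987934741886066034624102465058529188477036985899768882212721434564223007565987985546883321880083759490,
    225453760293828741093295621879728951995822940204332761797926013706049574781934574523560513444984834006457934694489101896549579923946565342951811088512,
    225478345587953763866098375502882191062108984066943666085281937723340988426701527505684742499668715023140709750710627119405636109359124094661156668036,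
    225453760294012637012298323323600825233246190193994336080237406353111543555343206368410937369849552132810647689357019946231679851091809023948132254082,
    225453760294107137270562134676451396184355628832378124213362979959130762272339219296638541620815940653236853514482528246443786437701098621290074342020]

/-- The blocks of a candelabra system of type `(12⁴ 18¹ : 6)` with a stem point removed. -/
def candelabraQuads : List Quad :=
  ((perms₂.flatMap fun h => perms₃.flatMap fun k => regularBases.map (permute h ∘ permute k)) ++
    perms₃.flatMap (fun k => bases₃.map (permute k)) ++
    perms₂.flatMap fun h => bases₂.map (permute h)).map sortQuad

/-- The blocks of a holey packing quadruple system on 71 points with hole `{48, …, 70}`. -/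
def holeyQuads : List Quad :=
  candelabraQuads ++ (List.range 4).flatMap fun j =>
    let f x := bif Nat.blt x 12 then 12 * j + x else 54 + x
    holeQuads.map fun (a, b, c, d) => (f a, f b, f c, f d)

/-- The quadruples with two points in each of two groups `{12 * i, …, 12 * i + 11}`, `i < m`, that
lie over edges from the same class of `F`. -/
def pairProducts (m : ℕ) (F : List (List (ℕ × ℕ))) : List Quad :=
  (List.range m).flatMap fun j => (List.range j).flatMap fun i => F.flatMap fun f =>
    f.flatMap fun p => f.map fun q => (12 * i + p.1, 12 * i + p.2, 12 * j + q.1, 12 * j + q.2)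

/-- A one-factorization of the graph on `ℤ/12` joining points at distance at least 2. -/
def oneFactors : List (List (ℕ × ℕ)) :=
  [[(0, 2), (1, 8), (3, 7), (4, 9), (5, 10), (6, 11)],
    [(0, 3), (1, 11), (2, 6), (4, 10), (5, 8), (7, 9)],
    [(0, 4), (1, 6), (2, 8), (3, 9), (5, 11), (7, 10)],
    [(0, 5), (1, 9), (2, 7), (3, 6), (4, 11), (8, 10)],
    [(0, 6), (1, 5), (2, 10), (3, 8), (4, 7), (9, 11)],
    [(0, 7), (1, 3), (2, 11), (4, 8), (5, 9), (6, 10)],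
    [(0, 8), (1, 4), (2, 5), (3, 10), (6, 9), (7, 11)],
    [(0, 9), (1, 10), (2, 4), (3, 11), (5, 7), (6, 8)],
    [(0, 10), (1, 7), (2, 9), (3, 5), (4, 6), (8, 11)]]

/-- The blocks of a candelabra system of type `(12³ : 6)`. -/
def candelabra₃ : List Quad :=
  (((List.range 12).flatMap fun x => (List.range 12).flatMap fun y =>
    [(x, 12 + y, 24 + (24 - x - y) % 12, 24 + (25 - x - y) % 12),
      (24 + x, y, 12 + (26 - x - y) % 12, 12 + (27 - x - y) % 12),
      (12 + x, 24 + y, (28 - x - y) % 12, (29 - x - y) % 12)] ++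
    (List.range 6).map fun s => (x, 12 + y, 24 + (30 + s - x - y) % 12, 36 + s)) ++
  pairProducts 3 oneFactors).map sortQuad

/-- The transversal blocks of a candelabra system of type `(4⁴ : 2)`. -/
def transversals₄ : List Quad :=
  [(0, 0, 0, 3), (0, 0, 1, 1), (0, 0, 2, 0), (0, 1, 1, 2), (0, 1, 2, 3), (0, 1, 3, 1),
    (0, 2, 0, 0), (0, 2, 2, 2), (0, 2, 3, 3), (0, 3, 0, 1), (0, 3, 1, 0), (0, 3, 3, 2),
    (1, 0, 0, 2), (1, 0, 1, 0), (1, 0, 3, 3), (1, 1, 0, 1), (1, 1, 2, 2), (1, 1, 3, 0),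
    (1, 2, 1, 3), (1, 2, 2, 0), (1, 2, 3, 1), (1, 3, 0, 3), (1, 3, 1, 2), (1, 3, 2, 1),
    (2, 0, 1, 2), (2, 0, 2, 1), (2, 0, 3, 0), (2, 1, 0, 2), (2, 1, 1, 3), (2, 1, 2, 0),
    (2, 2, 0, 3), (2, 2, 1, 1), (2, 2, 3, 2), (2, 3, 0, 0), (2, 3, 2, 3), (2, 3, 3, 1),
    (3, 0, 0, 1), (3, 0, 2, 3), (3, 0, 3, 2), (3, 1, 0, 0), (3, 1, 1, 1), (3, 1, 3, 3),
    (3, 2, 0, 2), (3, 2, 1, 0), (3, 2, 2, 1), (3, 3, 1, 3), (3, 3, 2, 2), (3, 3, 3, 0)]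

/-- The blocks of a candelabra system of type `(4⁴ : 2)` with a stem point: `(s, i, x, y, z)` has
stem point `s` and, in increasing order, points `x, y, z` of the groups other than `i`. -/
def stemTriples₄ : List (ℕ × ℕ × ℕ × ℕ × ℕ) :=
  [(1, 0, 0, 0, 0), (0, 0, 0, 1, 3), (1, 0, 0, 2, 2), (0, 0, 0, 3, 1), (1, 0, 1, 0, 3),
    (0, 0, 1, 1, 0), (1, 0, 1, 2, 1), (0, 0, 1, 3, 2), (0, 0, 2, 0, 1), (1, 0, 2, 1, 2),
    (0, 0, 2, 2, 3), (1, 0, 2, 3, 0), (0, 0, 3, 0, 2), (1, 0, 3, 1, 1), (0, 0, 3, 2, 0),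
    (1, 0, 3, 3, 3), (1, 1, 0, 0, 2), (1, 1, 0, 1, 3), (0, 1, 0, 2, 1), (0, 1, 0, 3, 0),
    (0, 1, 1, 0, 0), (0, 1, 1, 1, 1), (1, 1, 1, 2, 3), (1, 1, 1, 3, 2), (1, 1, 2, 0, 1),
    (1, 1, 2, 1, 0), (0, 1, 2, 2, 2), (0, 1, 2, 3, 3), (0, 1, 3, 0, 3), (0, 1, 3, 1, 2),
    (1, 1, 3, 2, 0), (1, 1, 3, 3, 1), (0, 2, 0, 0, 2), (1, 2, 0, 1, 0), (1, 2, 0, 2, 1),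
    (0, 2, 0, 3, 3), (1, 2, 1, 0, 1), (0, 2, 1, 1, 3), (0, 2, 1, 2, 2), (1, 2, 1, 3, 0),
    (1, 2, 2, 0, 3), (0, 2, 2, 1, 1), (0, 2, 2, 2, 0), (1, 2, 2, 3, 2), (0, 2, 3, 0, 0),
    (1, 2, 3, 1, 2), (1, 2, 3, 2, 3), (0, 2, 3, 3, 1), (1, 3, 0, 0, 3), (0, 3, 0, 1, 0),
    (0, 3, 0, 2, 1), (1, 3, 0, 3, 2), (0, 3, 1, 0, 2), (1, 3, 1, 1, 1), (1, 3, 1, 2, 0),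
    (0, 3, 1, 3, 3), (0, 3, 2, 0, 0), (1, 3, 2, 1, 3), (1, 3, 2, 2, 2), (0, 3, 2, 3, 1),
    (1, 3, 3, 0, 1), (0, 3, 3, 1, 2), (0, 3, 3, 2, 3), (1, 3, 3, 3, 0)]

/-- A one-factorization of the complete graph on `{0, …, 11}`. -/
def completeFactors : List (List (ℕ × ℕ)) :=
  (List.range 11).map fun k => (k, 11) ::
    (List.range 5).map fun i => ((k + i + 1) % 11, (k + 10 - i) % 11)

/-- The blocks of a candelabra system of type `(12⁴ : 6)`. -/
def candelabra₄ : List Quad :=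
  ((transversals₄.flatMap fun (w, x, y, z) =>
    (List.range 3).flatMap fun p => (List.range 3).flatMap fun q => (List.range 3).map fun r =>
      (3 * w + p, 12 + 3 * x + q, 24 + 3 * y + r, 36 + 3 * z + (6 - p - q - r) % 3)) ++
  (stemTriples₄.flatMap fun (s, i, x, y, z) =>
    (List.range 3).flatMap fun p => (List.range 3).flatMap fun q => (List.range 3).map fun r =>
      ((bif Nat.blt 0 i then 0 else 12) + 3 * x + p, (bif Nat.blt 1 i then 12 else 24) + 3 * y + q,
        (bif Nat.blt 2 i then 24 else 36) + 3 * z + r, 48 + 3 * s + (6 - p - q - r) % 3)) ++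
  pairProducts 4 completeFactors).map sortQuad

end Data

section Assembly

theorem isPacking_stemQuads : isPacking 23 stemQuads 0 = true := by decide +kernel

theorem isPacking_holeyQuads : isPacking 71 holeyQuads 0 = true := by decide +kernel

theorem length_holeyQuads : holeyQuads.length = 13656 := by decide +kernel

/-- Every block has at most two points in the hole. -/
theorem all_holeyQuads : (holeyQuads.all fun q => Nat.blt q.2.1 48) = true := by decide +kernel

/-- Move the points outside the hole `{48, …, 70}` to the group `{48 * i, …, 48 * i + 47}` and the
hole to `{48 * m, …, 48 * m + 22}`. -/
def place (m i x : ℕ) : ℕ := if x < 48 then 48 * i + x else 48 * m + (x - 48)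

theorem place_injOn {m i : ℕ} (hi : i < m) : Set.InjOn (place m i) Set.univ := by
  intro x _ y _ hxy
  simp only [place] at hxy
  split_ifs at hxy <;> omega

/-- The blocks in a group of size 48 together with the stem. -/
def groupBlocks (m i : ℕ) : Finset (Finset ℕ) :=
  (quadBlocks holeyQuads).image (Finset.image (place m i))

/-- The blocks in the stem. -/
def stemBlocks (m : ℕ) : Finset (Finset ℕ) :=
  (quadBlocks stemQuads).image (Finset.image (48 * m + ·))

/-- The result of filling the groups of an inflated candelabra system. -/
def filledBlocks (m : ℕ) (l : List Quad) : Finset (Finset ℕ) :=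
  inflation m l ∪ (range m).biUnion (groupBlocks m) ∪ stemBlocks m

variable {m i x : ℕ} {b : Finset ℕ}

theorem groupBlocks_spec (hi : i < m) :
    IsQuadPacking (groupBlocks m i) ∧ #(groupBlocks m i) = 13656 := by
  rw [← length_holeyQuads, ← card_quadBlocks isPacking_holeyQuads]
  exact (isQuadPacking_quadBlocks isPacking_holeyQuads).image (fun _ _ => Set.subset_univ _)
    (place_injOn hi)

theorem stemBlocks_spec : IsQuadPacking (stemBlocks m) ∧ #(stemBlocks m) = 419 := by
  have hlen : stemQuads.length = 419 := by decide +kernel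
  rw [← hlen, ← card_quadBlocks isPacking_stemQuads]
  exact (isQuadPacking_quadBlocks isPacking_stemQuads).image (fun _ _ => Set.subset_univ _)
    (add_right_injective _).injOn

theorem bounds_of_mem_stemBlocks (hb : b ∈ stemBlocks m) (hx : x ∈ b) :
    48 * m ≤ x ∧ x < 48 * m + 23 := by
  rw [stemBlocks, mem_image] at hb
  obtain ⟨b, hb, rfl⟩ := hb
  obtain ⟨y, hy, rfl⟩ := mem_image.1 hx
  have := lt_of_mem_quadBlocks isPacking_stemQuads hb hy
  omega

theorem bounds_of_mem_groupBlocks (hi : i < m) (hb : b ∈ groupBlocks m i) (hx : x ∈ b) :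
    (x / 48 = i ∨ 48 * m ≤ x) ∧ x < 48 * m + 23 := by
  rw [groupBlocks, mem_image] at hb
  obtain ⟨b, hb, rfl⟩ := hb
  obtain ⟨y, hy, rfl⟩ := mem_image.1 hx
  have := lt_of_mem_quadBlocks isPacking_holeyQuads hb hy
  unfold place
  split_ifs <;> omega

theorem card_filter_groupBlocks_le (hi : i < m) (hb : b ∈ groupBlocks m i) :
    #{x ∈ b | 48 * m ≤ x} ≤ 2 := by
  rw [groupBlocks, mem_image] at hb
  obtain ⟨b, hb, rfl⟩ := hb
  simp only [quadBlocks, List.mem_toFinset, List.mem_map] at hb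
  obtain ⟨⟨a, b, c, d⟩, hq, rfl⟩ := hb
  have hinc := isIncreasing_iff.1 (isIncreasing_of_isPacking isPacking_holeyQuads hq)
  have hb : b < 48 := by simpa using List.all_eq_true.1 all_holeyQuads _ hq
  refine (card_le_card (t := {place m i c, place m i d}) fun x hx => ?_).trans card_le_two
  simp only [Quad.points, image_insert, image_singleton, mem_filter, mem_insert,
    mem_singleton] at hx ⊢
  have h1 : place m i a < 48 * m := by rw [place, if_pos (by omega)]; omega
  have h2 : place m i b < 48 * m := by rw [place, if_pos hb]; omega
  omega

theorem filledBlocks_spec {l : List Quad} (h : isPacking (12 * m + 6) l 0 = true)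
    (hl : l.all (isDispersed m) = true) :
    IsQuadPacking (filledBlocks m l) ∧
      #(filledBlocks m l) = #(inflation m l) + m * 13656 + 419 := by
  obtain ⟨hG, hG'⟩ := IsQuadPacking.biUnion (I := range m) (F := groupBlocks m)
    (fun i hi => (groupBlocks_spec (mem_range.1 hi)).1) fun i hi j hj hij b hb b' hb' => by
      refine (card_le_card fun x hx => ?_).trans (card_filter_groupBlocks_le (mem_range.1 hi) hb)
      obtain ⟨hx, hx'⟩ := mem_inter.1 hx
      have h1 := (bounds_of_mem_groupBlocks (mem_range.1 hi) hb hx).1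
      have h2 := (bounds_of_mem_groupBlocks (mem_range.1 hj) hb' hx').1
      exact mem_filter.2 ⟨hx, by omega⟩
  obtain ⟨hC, hC'⟩ := (inflation_spec h).1.union hG fun b hb b' hb' => by
    obtain ⟨i, hi, hb'⟩ := mem_biUnion.1 hb'
    refine (card_le_card fun x hx => ?_).trans (card_filter_inflation_le h hl hb i)
    obtain ⟨hx, hx'⟩ := mem_inter.1 hx
    exact mem_filter.2 ⟨hx, (bounds_of_mem_groupBlocks (mem_range.1 hi) hb' hx').1⟩
  obtain ⟨hD, hD'⟩ := hC.union (stemBlocks_spec (m := m)).1 fun b hb b' hb' => by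
    rcases mem_union.1 hb with hb | hb
    · refine (card_le_card fun x hx => ?_).trans (card_filter_inflation_le h hl hb 0)
      obtain ⟨hx, hx'⟩ := mem_inter.1 hx
      exact mem_filter.2 ⟨hx, .inr (bounds_of_mem_stemBlocks hb' hx').1⟩
    · obtain ⟨i, hi, hb⟩ := mem_biUnion.1 hb
      refine (card_le_card fun x hx => ?_).trans (card_filter_groupBlocks_le (mem_range.1 hi) hb)
      obtain ⟨hx, hx'⟩ := mem_inter.1 hx
      exact mem_filter.2 ⟨hx, (bounds_of_mem_stemBlocks hb' hx').1⟩
  refine ⟨hD, ?_⟩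
  rw [filledBlocks, hD', hC', hG', stemBlocks_spec.2,
    sum_congr rfl fun i hi => (groupBlocks_spec (mem_range.1 hi)).2, sum_const, card_range,
    smul_eq_mul]

theorem lt_of_mem_filledBlocks {l : List Quad} (h : isPacking (12 * m + 6) l 0 = true)
    (hb : b ∈ filledBlocks m l) (hx : x ∈ b) : x < 48 * m + 23 := by
  rcases mem_union.1 hb with hb | hb
  · rcases mem_union.1 hb with hb | hb
    · exact lt_of_mem_inflation h hb hx
    · obtain ⟨i, hi, hb⟩ := mem_biUnion.1 hb
      exact (bounds_of_mem_groupBlocks (mem_range.1 hi) hb hx).2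
  · exact (bounds_of_mem_stemBlocks hb hx).2

/-- A candelabra system of type `(12^m : 6)` with the right number of blocks yields an optimal
packing on `48 * m + 23` points. -/
theorem packingNumber_eq_of_candelabra {l : List Quad} (h : isPacking (12 * m + 6) l 0 = true)
    (hl : l.all (isDispersed m) = true) {n k : ℕ} (hn : n = 48 * m + 23)
    (hk : (l.map fun q => 16 * weight m q.2.2.2).sum = k)
    (hcard : k + 12 * #(crossPairs m) + m * 13656 + 419 =
      n * ((n - 1) * ((n - 2) / 2) / 3) / 4) :
    packingNumber n = n * ((n - 1) * ((n - 2) / 2) / 3) / 4 := by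
  obtain ⟨hB, hB'⟩ := filledBlocks_spec h hl
  obtain ⟨B, hP, hcard'⟩ :=
    hB.exists_isPQS (n := n) fun b hb x hx => hn ▸ lt_of_mem_filledBlocks h hb hx
  refine packingNumber_eq_of_card hP ?_
  rw [hcard', hB', (inflation_spec h).2, hk, hcard]

end Assembly

/-- For k ∈ {27, 35}, A(6k+5,4,4) = J(6k+5,4,4). -/
theorem packingNumber_167_215 :
    packingNumber 167 = johnsonBound 167 ∧
    packingNumber 215 = johnsonBound 215 := by
  constructor
  · have hcross : #(crossPairs 3) = 432 := by decide +kernel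
    exact packingNumber_eq_of_candelabra (m := 3) (l := candelabra₃) (k := 142848)
      (by decide +kernel) (by decide +kernel) rfl (by decide +kernel) (by rw [hcross])
  · have hcross : #(crossPairs 4) = 864 := by decide +kernel
    exact packingNumber_eq_of_candelabra (m := 4) (l := candelabra₄) (k := 340992)
      (by decide +kernel) (by decide +kernel) rfl (by decide +kernel) (by rw [hcross])
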